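/- For every residue function r̃ : ℕ_{>1} → ℕ, the L_⊗-theory T_r̃ is consistent. -/

import Mathlib

open FirstOrder FirstOrder.Language

namespace MSO

/-! ### The language `L_⊗` and its semantics -/

/-- The language `L_⊗`: a constant `⊥`, a unary relation `At`,
and two binary relations: `⊆` (encoded `true`) and `≤ᴱ` (encoded `false`). -/
def Lmso : Language where
  Functions := fun n => match n with | 0 => Unit | _ => Empty
  Relations := fun n => match n with | 1 => Unit | 2 => Bool | _ => Empty

/-- The constant symbol `⊥`. -/
def botC : Lmso.Constants := Unit.unit
/-- The unary relation symbol `At`. -/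
def atR : Lmso.Relations 1 := Unit.unit
/-- The binary relation symbol `⊆`. -/
def subR : Lmso.Relations 2 := true
/-- The binary relation symbol `≤ᴱ`. -/
def exleR : Lmso.Relations 2 := false

/-- The interpretation of `⊥` in an `L_⊗`-structure. -/
def botE (M : Type*) [Lmso.Structure M] : M := Structure.funMap botC ![]
/-- The interpretation of `At` in an `L_⊗`-structure. -/
def atE {M : Type*} [Lmso.Structure M] (a : M) : Prop := Structure.RelMap atR ![a]
/-- The interpretation of `⊆` in an `L_⊗`-structure. -/
def subE {M : Type*} [Lmso.Structure M] (a b : M) : Prop := Structure.RelMap subR ![a, b]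
/-- The interpretation of `≤ᴱ` in an `L_⊗`-structure. -/
def exleE {M : Type*} [Lmso.Structure M] (a b : M) : Prop := Structure.RelMap exleR ![a, b]

/-- The monadic second order version `M̃SO(α)` of a linear order `α`, as an `L_⊗`-structure:
the universe is the powerset of `α`, `⊆` is inclusion, `⊥` is `∅`, `At` holds of singletons,
and `A ≤ᴱ B` iff there are `a ∈ A` and `b ∈ B` with `a < b`. -/
instance msoStructure (α : Type*) [LinearOrder α] : Lmso.Structure (Set α) where
  funMap := fun {n} f _ => match n, f with
    | 0, _ => (∅ : Set α)
  RelMap := fun {n} r v => match n, r with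
    | 1, _ => ∃ a : α, v 0 = {a}
    | 2, true => v 0 ⊆ v 1
    | 2, false => ∃ a ∈ v 0, ∃ b ∈ v 1, a < b

/-- `MSO(n)`, the monadic second order version of the `n`-element linear order. -/
abbrev MSOn (n : ℕ) : Type := Set (Fin n)

/-- The operation `⊗` on `L_⊗`-structures: the universe is the product, `⊆` is componentwise,
`⊥` is the pair of bottoms, `At` holds of the atoms (minimal non-bottom elements) of the
resulting order, and `(A,B) ≤ᴱ (C,D)` iff (`A ≠ ⊥` and `D ≠ ⊥`), or `A ≤ᴱ C`, or `B ≤ᴱ D`. -/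
instance tensorStructure (M N : Type*) [Lmso.Structure M] [Lmso.Structure N] :
    Lmso.Structure (M × N) where
  funMap := fun {n} f _ => match n, f with
    | 0, _ => (botE M, botE N)
  RelMap := fun {n} r v => match n, r with
    | 1, _ => v 0 ≠ (botE M, botE N) ∧
        ∀ q : M × N, subE q.1 (v 0).1 → subE q.2 (v 0).2 →
          q = (botE M, botE N) ∨ q = v 0
    | 2, true => subE (v 0).1 (v 1).1 ∧ subE (v 0).2 (v 1).2
    | 2, false => ((v 0).1 ≠ botE M ∧ (v 1).2 ≠ botE N) ∨
        exleE (v 0).1 (v 1).1 ∨ exleE (v 0).2 (v 1).2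

/-! ### Formulas -/

/-- Bounded `L_⊗`-formulas with no free (outer) variables. -/
abbrev BF (n : ℕ) := Lmso.BoundedFormula Empty n

/-- The `i`-th de Bruijn variable as a term. -/
def tv {n : ℕ} (i : Fin n) : Lmso.Term (Empty ⊕ Fin n) := Term.var (Sum.inr i)
/-- The constant `⊥` as a term. -/
def tb {n : ℕ} : Lmso.Term (Empty ⊕ Fin n) := Constants.term botC

def sub' {n : ℕ} (i j : Fin n) : BF n := subR.boundedFormula₂ (tv i) (tv j)
def exle' {n : ℕ} (i j : Fin n) : BF n := exleR.boundedFormula₂ (tv i) (tv j)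
def at' {n : ℕ} (i : Fin n) : BF n := atR.boundedFormula₁ (tv i)
def eq' {n : ℕ} (i j : Fin n) : BF n := Term.bdEqual (tv i) (tv j)
def isBot' {n : ℕ} (i : Fin n) : BF n := Term.bdEqual (tv i) tb
def botSub' {n : ℕ} (i : Fin n) : BF n := subR.boundedFormula₂ tb (tv i)

/-- Finite conjunction. -/
def bigAnd {n : ℕ} (l : List (BF n)) : BF n := l.foldr (· ⊓ ·) ⊤
/-- Finite disjunction. -/
def bigOr {n : ℕ} (l : List (BF n)) : BF n := l.foldr (· ⊔ ·) ⊥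

/-- `k` is the meet of `i` and `j` (with respect to `⊆`). -/
def isMeet {n : ℕ} (k i j : Fin n) : BF n :=
  sub' k i ⊓ sub' k j ⊓
    ∀' ((sub' (Fin.last n) i.castSucc ⊓ sub' (Fin.last n) j.castSucc) ⟹
      sub' (Fin.last n) k.castSucc)

/-- `k` is the join of `i` and `j` (with respect to `⊆`). -/
def isJoin {n : ℕ} (k i j : Fin n) : BF n :=
  sub' i k ⊓ sub' j k ⊓
    ∀' ((sub' i.castSucc (Fin.last n) ⊓ sub' j.castSucc (Fin.last n)) ⟹
      sub' k.castSucc (Fin.last n))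

/-- The meet of `i` and `j` is `⊥`. -/
def meetIsBot {n : ℕ} (i j : Fin n) : BF n :=
  ∀' ((sub' (Fin.last n) i.castSucc ⊓ sub' (Fin.last n) j.castSucc) ⟹ isBot' (Fin.last n))

/-- The join of `i` and `j` is the top element. -/
def joinIsTop {n : ℕ} (i j : Fin n) : BF n :=
  ∀' ((sub' i.castSucc (Fin.last n) ⊓ sub' j.castSucc (Fin.last n)) ⟹
    ∀' (sub' (Fin.last (n + 1)) ((Fin.last n).castSucc)))

/-- `j` is a (Boolean) complement of `i`. -/
def isComplOf {n : ℕ} (j i : Fin n) : BF n := meetIsBot i j ⊓ joinIsTop i j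

/-- `i` is an atom: non-bottom, and minimal among non-bottom elements. -/
def isAtomDef {n : ℕ} (i : Fin n) : BF n :=
  ∼(isBot' i) ⊓
    ∀' (sub' (Fin.last n) i.castSucc ⟹ (isBot' (Fin.last n) ⊔ eq' (Fin.last n) i.castSucc))

/-! ### The base theory `T_base` -/

def axRefl : Lmso.Sentence := ∀' sub' 0 0
def axAntisymm : Lmso.Sentence := ∀' ∀' ((sub' 0 1 ⊓ sub' 1 0) ⟹ eq' 0 1)
def axTrans : Lmso.Sentence := ∀' ∀' ∀' ((sub' 0 1 ⊓ sub' 1 2) ⟹ sub' 0 2)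
def axBotLe : Lmso.Sentence := ∀' botSub' 0
def axTop : Lmso.Sentence := ∃' ∀' (sub' 1 0)
def axMeet : Lmso.Sentence := ∀' ∀' ∃' (isMeet 2 0 1)
def axJoin : Lmso.Sentence := ∀' ∀' ∃' (isJoin 2 0 1)
def axCompl : Lmso.Sentence := ∀' ∃' (isComplOf 1 0)
def axDistrib : Lmso.Sentence :=
  ∀' ∀' ∀' ∀' ∀' ∀' ∀' ∀'
    ((isMeet 3 0 1 ⊓ isMeet 4 0 2 ⊓ isJoin 5 1 2 ⊓ isMeet 6 0 5 ⊓ isJoin 7 3 4) ⟹ sub' 6 7)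
def axAt : Lmso.Sentence := ∀' (at' 0 ⇔ isAtomDef 0)
def axAtomic : Lmso.Sentence := ∀' (∼(isBot' 0) ⟹ ∃' (at' 1 ⊓ sub' 1 0))
def axIrrefl : Lmso.Sentence := ∀' (at' 0 ⟹ ∼(exle' 0 0))
def axTransAt : Lmso.Sentence :=
  ∀' ∀' ∀' ((at' 0 ⊓ at' 1 ⊓ at' 2 ⊓ exle' 0 1 ⊓ exle' 1 2) ⟹ exle' 0 2)
def axTrich : Lmso.Sentence :=
  ∀' ∀' ((at' 0 ⊓ at' 1) ⟹ (exle' 0 1 ⊔ eq' 0 1 ⊔ exle' 1 0))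
def axExleDef : Lmso.Sentence :=
  ∀' ∀' (exle' 0 1 ⇔ ∃' ∃' (at' 2 ⊓ at' 3 ⊓ sub' 2 0 ⊓ sub' 3 1 ⊓ exle' 2 3))

/-- The comprehension axiom for a formula `η(x; Y₁,…,Yₙ)` (with `x` the last variable):
`∀ Ȳ ∃ X ∀ x (At x → (x ⊆ X ↔ η(x; Ȳ)))`. -/
def compAx {n : ℕ} (η : BF (n + 1)) : Lmso.Sentence :=
  BoundedFormula.alls (∃' ∀' (at' (Fin.last (n + 1)) ⟹
    (sub' (Fin.last (n + 1)) ((Fin.last n).castSucc) ⇔ η.liftAt 1 n)))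

/-- The base theory `T_base`: an atomic Boolean algebra under `⊆` with bottom `⊥`, `At`
holding exactly of the atoms, `≤ᴱ` linearly ordering the atoms and determined by its
restriction to the atoms, together with the comprehension scheme. -/
def Tbase : Lmso.Theory :=
  {axRefl, axAntisymm, axTrans, axBotLe, axTop, axMeet, axJoin, axCompl, axDistrib,
    axAt, axAtomic, axIrrefl, axTransAt, axTrich, axExleDef} ∪
  ⋃ n : ℕ, Set.range (compAx (n := n))

/-! ### The theory `T_MSO(Fin)` -/

/-- `i` is the `≤ᴱ`-least atom. -/
def isLeastAtom {n : ℕ} (i : Fin n) : BF n :=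
  at' i ⊓ ∀' (at' (Fin.last n) ⟹ ∼(exle' (Fin.last n) i.castSucc))

/-- `i` is the `≤ᴱ`-greatest atom. -/
def isGreatestAtom {n : ℕ} (i : Fin n) : BF n :=
  at' i ⊓ ∀' (at' (Fin.last n) ⟹ ∼(exle' i.castSucc (Fin.last n)))

/-- `j` is the immediate `≤ᴱ`-successor of the atom `i`. -/
def isSuccOf {n : ℕ} (j i : Fin n) : BF n :=
  at' i ⊓ at' j ⊓ exle' i j ⊓
    ∀' ((at' (Fin.last n) ⊓ exle' i.castSucc (Fin.last n)) ⟹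
      (eq' (Fin.last n) j.castSucc ⊔ exle' j.castSucc (Fin.last n)))

def axLeastAtom : Lmso.Sentence := (∃' at' 0) ⟹ ∃' isLeastAtom 0
def axGreatestAtom : Lmso.Sentence := (∃' at' 0) ⟹ ∃' isGreatestAtom 0
def axSucc : Lmso.Sentence :=
  ∀' ((at' 0 ⊓ ∃' (at' 1 ⊓ exle' 0 1)) ⟹ ∃' isSuccOf 1 0)
def axPred : Lmso.Sentence :=
  ∀' ((at' 0 ⊓ ∃' (at' 1 ⊓ exle' 1 0)) ⟹ ∃' isSuccOf 0 1)
def axLeastIn : Lmso.Sentence :=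
  ∀' (∼(isBot' 0) ⟹ ∃' (at' 1 ⊓ sub' 1 0 ⊓ ∀' ((at' 2 ⊓ sub' 2 0) ⟹ ∼(exle' 2 1))))

/-- The theory `T_MSO(Fin)`: `T_base` together with axioms saying that the ordering of the
atoms is discrete with endpoints, and every non-bottom element contains a least atom. -/
def TMSOFin : Lmso.Theory :=
  Tbase ∪ {axLeastAtom, axGreatestAtom, axSucc, axPred, axLeastIn}

/-! ### Quantifier rank, unnested formulas, and `≈ₖ` -/

/-- Quantifier rank of a bounded formula. -/
def qr : ∀ {n : ℕ}, BF n → ℕ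
  | _, BoundedFormula.falsum => 0
  | _, BoundedFormula.equal _ _ => 0
  | _, BoundedFormula.rel _ _ => 0
  | _, BoundedFormula.imp f g => max (qr f) (qr g)
  | _, BoundedFormula.all f => qr f + 1

/-- A formula is unnested if every atomic subformula is of one of the forms
`x = y`, `c = y`, or `R x̄` with the `xᵢ`, `y` variables (Hodges). -/
def IsUnnested : ∀ {n : ℕ}, BF n → Prop
  | _, BoundedFormula.falsum => True
  | _, BoundedFormula.equal s t =>
      (∃ i j, s = Term.var i ∧ t = Term.var j) ∨
      (∃ (c : Lmso.Constants) (j : _), s = Constants.term c ∧ t = Term.var j)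
  | _, BoundedFormula.rel _ ts => ∀ i, ∃ j, ts i = Term.var j
  | _, BoundedFormula.imp f g => IsUnnested f ∧ IsUnnested g
  | _, BoundedFormula.all f => IsUnnested f

/-- `M ≈ₖ N` : `M` and `N` satisfy the same unnested `L_⊗`-sentences of quantifier
rank at most `k`. -/
def EquivK (k : ℕ) (M N : Type*) [Lmso.Structure M] [Lmso.Structure N] : Prop :=
  ∀ φ : Lmso.Sentence, IsUnnested φ → qr φ ≤ k → (M ⊨ φ ↔ N ⊨ φ)

/-! ### The sentences `ρ_{d,h}`, `ψ_{>n}`, `ψ_{=n}` -/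

/-- The index (in `Fin d`) of `A_h` among `A₁, …, A_d`, identifying `h = 0` with `h = d`. -/
def aIdx (d h : ℕ) (hd : 0 < d) : Fin d := ⟨(h + d - 1) % d, Nat.mod_lt _ hd⟩

/-- The cyclic successor on the indices `{1, …, d}`. -/
def cyc {d : ℕ} (j : Fin d) : Fin d := ⟨((j : ℕ) + 1) % d, Nat.mod_lt _ j.pos⟩

/-- The sentence `ρ_{d,h}`: there is a partition of the atoms into `d` non-bottom elements
`A₁, …, A_d` such that the least atom is in `A₁`, the immediate successor of an atom lying in
`A_j` lies in `A_{j+1}` (cyclically), and the greatest atom is in `A_h`. -/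
def rho (d h : ℕ) : Lmso.Sentence :=
  if hd : 0 < d then
    BoundedFormula.exs (n := d) (
      -- each `A_i` is non-bottom
      bigAnd ((List.finRange d).map fun i => ∼(isBot' i)) ⊓
      -- every atom lies in some `A_i`
      (∀' (at' (Fin.last d) ⟹
        bigOr ((List.finRange d).map fun i => sub' (Fin.last d) i.castSucc))) ⊓
      -- the `A_i` are pairwise disjoint on atoms
      bigAnd ((List.finRange d).flatMap fun i => (List.finRange d).filterMap fun j =>
        if i.val < j.val then
          some (∀' (at' (Fin.last d) ⟹
            ∼(sub' (Fin.last d) i.castSucc ⊓ sub' (Fin.last d) j.castSucc)))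
        else none) ⊓
      -- the least atom lies in `A₁`
      (∀' (isLeastAtom (Fin.last d) ⟹ sub' (Fin.last d) ((aIdx d 1 hd).castSucc))) ⊓
      -- immediate successors move cyclically through the `A_j`
      bigAnd ((List.finRange d).map fun j =>
        ∀' ∀' ((sub' ((Fin.last d).castSucc) (j.castSucc.castSucc) ⊓
            isSuccOf (Fin.last (d + 1)) ((Fin.last d).castSucc)) ⟹
          sub' (Fin.last (d + 1)) ((cyc j).castSucc.castSucc))) ⊓
      -- the greatest atom lies in `A_h`
      (∀' (isGreatestAtom (Fin.last d) ⟹ sub' (Fin.last d) ((aIdx d h hd).castSucc))))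
  else ⊥

/-- The list of formulas `xᵢ ≠ xⱼ` for `i < j < n`. -/
def distinctPairs (n : ℕ) : List (BF n) :=
  (List.finRange n).flatMap fun i => (List.finRange n).filterMap fun j =>
    if i.val < j.val then some (∼(eq' i j)) else none

/-- `ψ_{>n}` : there exist at least `n + 1` distinct atoms. -/
def psiGt (n : ℕ) : Lmso.Sentence :=
  BoundedFormula.exs (n := n + 1)
    (bigAnd ((List.finRange (n + 1)).map fun i => at' i) ⊓ bigAnd (distinctPairs (n + 1)))

/-- `ψ_{=n}` : there exist exactly `n` distinct atoms. -/
def psiEq (n : ℕ) : Lmso.Sentence :=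
  BoundedFormula.exs (n := n)
    (bigAnd ((List.finRange n).map fun i => at' i) ⊓ bigAnd (distinctPairs n) ⊓
      ∀' (at' (Fin.last n) ⟹ bigOr ((List.finRange n).map fun i => eq' (Fin.last n) i.castSucc)))

/-! ### Residue functions and the theories `T_r̃` -/

/-- A residue function `ℙ × ℕ_{>0} → ℕ` (conditions imposed only at primes `p` and `j ≥ 1`):
`r(p,j) < p^j` and `r(p,j+1) ≡ r(p,j) [MOD p^j]`. -/
def IsResidueFunction (r : ℕ → ℕ → ℕ) : Prop :=
  ∀ p j : ℕ, p.Prime → 1 ≤ j → r p j < p ^ j ∧ r p (j + 1) ≡ r p j [MOD p ^ j]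

/-- A function `ℕ_{>1} → ℕ` is a residue function if it arises from a residue function
`ℙ × ℕ_{>0} → ℕ` as in the paper (conditions imposed only for `d > 1`). -/
def IsResidueFunctionTilde (rt : ℕ → ℕ) : Prop :=
  ∃ r : ℕ → ℕ → ℕ, IsResidueFunction r ∧
    ∀ d : ℕ, 1 < d → rt d < d ∧
      ∀ p j : ℕ, p.Prime → 1 ≤ j → p ^ j ∣ d → rt d ≡ r p j [MOD p ^ j]

/-- The theory `T_r̃ = T_MSO(Fin) ∪ {ψ_{>n} : n ∈ ℕ} ∪ {ρ_{d,r̃(d)} : d > 1}`. -/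
def Trt (rt : ℕ → ℕ) : Lmso.Theory :=
  TMSOFin ∪ Set.range psiGt ∪ {σ : Lmso.Sentence | ∃ d : ℕ, 1 < d ∧ σ = rho d (rt d)}

/-! ### Relativization and the sum of sentences -/

/-- Relativization of a formula to the elements `⊆ v`:
each quantifier `∀ Z (…)` becomes `∀ Z (Z ⊆ v → …)`. -/
def relv : ∀ {n : ℕ}, BF n → Fin n → BF n
  | _, BoundedFormula.falsum, _ => BoundedFormula.falsum
  | _, BoundedFormula.equal s t, _ => BoundedFormula.equal s t
  | _, BoundedFormula.rel r ts, _ => BoundedFormula.rel r ts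
  | _, BoundedFormula.imp f g, v => (relv f v).imp (relv g v)
  | n, BoundedFormula.all f, v =>
      BoundedFormula.all (sub' (Fin.last n) v.castSucc ⟹ relv f v.castSucc)

/-- `i` is downward closed with respect to the `≤ᴱ`-ordering of the atoms. -/
def dwcl' {n : ℕ} (i : Fin n) : BF n :=
  ∀' ∀' ((at' ((Fin.last n).castSucc) ⊓ at' (Fin.last (n + 1)) ⊓
      sub' ((Fin.last n).castSucc) (i.castSucc.castSucc) ⊓
      exle' (Fin.last (n + 1)) ((Fin.last n).castSucc)) ⟹
    sub' (Fin.last (n + 1)) (i.castSucc.castSucc))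

/-- The sentence `φ + ψ` : `∃ X (X downward closed ∧ φ^X ∧ ψ^(Xᶜ))`
(with the complement `Xᶜ` introduced by an existential quantifier). -/
def plusSent (φ ψ : Lmso.Sentence) : Lmso.Sentence :=
  ∃' ∃' (dwcl' (0 : Fin 2) ⊓ isComplOf (1 : Fin 2) (0 : Fin 2) ⊓
    relv (φ.liftAt 2 0) (0 : Fin 2) ⊓ relv (ψ.liftAt 2 0) (1 : Fin 2))

/-! ### `FSpec` and ultimate periodicity -/

/-- `FSpec φ` : the set of `n ∈ ℕ` such that `MSO(n) ⊨ φ`. -/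
def FSpec (φ : Lmso.Sentence) : Set ℕ := {n : ℕ | MSOn n ⊨ φ}

/-- A set of naturals is ultimately periodic. -/
def UltPeriodic (S : Set ℕ) : Prop :=
  ∃ N d : ℕ, 0 < d ∧ ∀ n : ℕ, N < n → (n ∈ S ↔ n + d ∈ S)

/-! ### The language `L_MO = {⊆, <}` -/

/-- The language `L_MO` with two binary relations: `⊆` (encoded `true`) and `<`
(encoded `false`). -/
def Lmo : Language where
  Functions := fun _ => Empty
  Relations := fun n => match n with | 2 => Bool | _ => Empty

/-- The monadic second order version `MSO(α)` of a linear order `α` as an `L_MO`-structure: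
`⊆` is inclusion and `<` is the ordering of `α` on singletons. -/
instance moStructure (α : Type*) [LinearOrder α] : Lmo.Structure (Set α) where
  funMap := fun f _ => f.elim
  RelMap := fun {n} r v => match n, r with
    | 2, true => v 0 ⊆ v 1
    | 2, false => ∃ a b : α, v 0 = {a} ∧ v 1 = {b} ∧ a < b

section Realize

variable {α : Type*} [LinearOrder α] {n : ℕ} {v : Empty → Set α} {xs : Fin n → Set α}

@[simp]
theorem realize_tv (i : Fin n) : (tv i).realize (Sum.elim v xs) = xs i := rfl

@[simp]
theorem realize_tb : (tb : Lmso.Term (Empty ⊕ Fin n)).realize (Sum.elim v xs) = (∅ : Set α) := rfl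

@[simp]
theorem realize_sub' (i j : Fin n) : (sub' i j).Realize v xs ↔ xs i ⊆ xs j := by
  rw [sub', BoundedFormula.realize_rel₂]; rfl

@[simp]
theorem realize_exle' (i j : Fin n) :
    (exle' i j).Realize v xs ↔ ∃ a ∈ xs i, ∃ b ∈ xs j, a < b := by
  rw [exle', BoundedFormula.realize_rel₂]; rfl

@[simp]
theorem realize_at' (i : Fin n) : (at' i).Realize v xs ↔ ∃ a, xs i = {a} := by
  rw [at', BoundedFormula.realize_rel₁]; rfl

@[simp]
theorem realize_eq' (i j : Fin n) : (eq' i j).Realize v xs ↔ xs i = xs j := Iff.rfl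

@[simp]
theorem realize_isBot' (i : Fin n) : (isBot' i).Realize v xs ↔ xs i = ∅ := Iff.rfl

@[simp]
theorem realize_botSub' (i : Fin n) : (botSub' i).Realize v xs := by
  rw [botSub', BoundedFormula.realize_rel₂]
  exact Set.empty_subset _

@[simp]
theorem realize_bigAnd (l : List (BF n)) :
    (bigAnd l).Realize v xs ↔ ∀ φ ∈ l, φ.Realize v xs :=
  BoundedFormula.realize_foldr_inf l v xs

@[simp]
theorem realize_bigOr (l : List (BF n)) :
    (bigOr l).Realize v xs ↔ ∃ φ ∈ l, φ.Realize v xs :=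
  BoundedFormula.realize_foldr_sup l v xs

@[simp]
theorem realize_isMeet (k i j : Fin n) :
    (isMeet k i j).Realize v xs ↔ xs k = xs i ∩ xs j := by
  simp only [isMeet, BoundedFormula.realize_inf, realize_sub', BoundedFormula.realize_all,
    BoundedFormula.realize_imp, Fin.snoc_last, Fin.snoc_castSucc]
  constructor
  · rintro ⟨⟨h₁, h₂⟩, h₃⟩
    exact (Set.subset_inter h₁ h₂).antisymm
      (h₃ _ ⟨Set.inter_subset_left, Set.inter_subset_right⟩)
  · intro h
    rw [h]
    exact ⟨⟨Set.inter_subset_left, Set.inter_subset_right⟩, fun _ h => Set.subset_inter h.1 h.2⟩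

@[simp]
theorem realize_isJoin (k i j : Fin n) :
    (isJoin k i j).Realize v xs ↔ xs k = xs i ∪ xs j := by
  simp only [isJoin, BoundedFormula.realize_inf, realize_sub', BoundedFormula.realize_all,
    BoundedFormula.realize_imp, Fin.snoc_last, Fin.snoc_castSucc]
  constructor
  · rintro ⟨⟨h₁, h₂⟩, h₃⟩
    exact (h₃ _ ⟨Set.subset_union_left, Set.subset_union_right⟩).antisymm
      (Set.union_subset h₁ h₂)
  · intro h
    rw [h]
    exact ⟨⟨Set.subset_union_left, Set.subset_union_right⟩, fun _ h => Set.union_subset h.1 h.2⟩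

theorem realize_isComplOf_of_eq_compl {i j : Fin n} (h : xs j = (xs i)ᶜ) :
    (isComplOf j i).Realize v xs := by
  simp only [isComplOf, meetIsBot, joinIsTop, BoundedFormula.realize_inf, realize_sub',
    BoundedFormula.realize_all, BoundedFormula.realize_imp, Fin.snoc_last, Fin.snoc_castSucc,
    realize_isBot', h]
  refine ⟨fun a ha => ?_, fun a ha b x _ => ?_⟩
  · simpa using Set.subset_inter ha.1 ha.2
  · by_cases hx : x ∈ xs i
    exacts [ha.1 hx, ha.2 hx]

@[simp]
theorem realize_isAtomDef (i : Fin n) :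
    (isAtomDef i).Realize v xs ↔ ∃ a, xs i = {a} := by
  simp only [isAtomDef, BoundedFormula.realize_inf, BoundedFormula.realize_not, realize_sub',
    BoundedFormula.realize_all, BoundedFormula.realize_imp, Fin.snoc_last, Fin.snoc_castSucc,
    realize_isBot', BoundedFormula.realize_sup, realize_eq']
  constructor
  · rintro ⟨h₁, h₂⟩
    obtain ⟨a, ha⟩ := Set.nonempty_iff_ne_empty.2 h₁
    refine ⟨a, ((h₂ {a} (by simpa using ha)).resolve_left (by simp)).symm⟩
  · rintro ⟨a, ha⟩
    rw [ha]
    exact ⟨by simp, fun b hb => Set.subset_singleton_iff_eq.1 hb⟩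

@[simp]
theorem realize_isLeastAtom (i : Fin n) :
    (isLeastAtom i).Realize v xs ↔ ∃ a, xs i = {a} ∧ ∀ b, a ≤ b := by
  simp only [isLeastAtom, BoundedFormula.realize_inf, BoundedFormula.realize_not, realize_at',
    BoundedFormula.realize_all, BoundedFormula.realize_imp, Fin.snoc_last, Fin.snoc_castSucc,
    realize_exle']
  constructor
  · rintro ⟨⟨a, ha⟩, h⟩
    exact ⟨a, ha, fun b => by simpa [ha] using h {b} ⟨b, rfl⟩⟩
  · rintro ⟨a, ha, h⟩
    refine ⟨⟨a, ha⟩, ?_⟩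
    rintro _ ⟨b, rfl⟩
    simpa [ha] using h b

@[simp]
theorem realize_isGreatestAtom (i : Fin n) :
    (isGreatestAtom i).Realize v xs ↔ ∃ a, xs i = {a} ∧ ∀ b, b ≤ a := by
  simp only [isGreatestAtom, BoundedFormula.realize_inf, BoundedFormula.realize_not, realize_at',
    BoundedFormula.realize_all, BoundedFormula.realize_imp, Fin.snoc_last, Fin.snoc_castSucc,
    realize_exle']
  constructor
  · rintro ⟨⟨a, ha⟩, h⟩
    exact ⟨a, ha, fun b => by simpa [ha] using h {b} ⟨b, rfl⟩⟩
  · rintro ⟨a, ha, h⟩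
    refine ⟨⟨a, ha⟩, ?_⟩
    rintro _ ⟨b, rfl⟩
    simpa [ha] using h b

@[simp]
theorem realize_isSuccOf (j i : Fin n) :
    (isSuccOf j i).Realize v xs ↔ ∃ a b, xs i = {a} ∧ xs j = {b} ∧ a ⋖ b := by
  simp only [isSuccOf, BoundedFormula.realize_inf, BoundedFormula.realize_sup, realize_at',
    BoundedFormula.realize_all, BoundedFormula.realize_imp, Fin.snoc_last, Fin.snoc_castSucc,
    realize_exle', realize_eq']
  constructor
  · rintro ⟨⟨⟨⟨a, ha⟩, b, hb⟩, hab⟩, h⟩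
    simp only [ha, hb, Set.mem_singleton_iff, exists_eq_left] at hab h
    refine ⟨a, b, ha, hb, hab, fun c hac hcb => ?_⟩
    rcases h {c} ⟨⟨c, rfl⟩, c, rfl, hac⟩ with h | ⟨_, rfl, h⟩
    · exact hcb.ne (Set.singleton_injective h)
    · exact lt_asymm h hcb
  · rintro ⟨a, b, ha, hb, hab⟩
    refine ⟨⟨⟨⟨a, ha⟩, b, hb⟩, by simpa [ha, hb] using hab.1⟩, ?_⟩
    rintro _ ⟨⟨c, rfl⟩, hc⟩
    simp only [ha, hb, Set.mem_singleton_iff, exists_eq_left] at hc ⊢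
    rcases lt_trichotomy b c with h | h | h
    · exact Or.inr h
    · exact Or.inl (by rw [h])
    · exact absurd h (hab.2 hc)

end Realize

theorem models_compAx (α : Type*) [LinearOrder α] {n : ℕ} (η : BF (n + 1)) :
    Set α ⊨ compAx η := by
  rw [compAx, Sentence.Realize, BoundedFormula.realize_alls]
  intro xs
  rw [BoundedFormula.realize_ex]
  refine ⟨{a | η.Realize default (Fin.snoc xs {a})}, ?_⟩
  rw [BoundedFormula.realize_all]
  intro x
  rw [BoundedFormula.realize_imp, realize_at', BoundedFormula.realize_iff,
    BoundedFormula.realize_liftAt_one (Nat.le_succ n), realize_sub']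
  rintro ⟨a, ha⟩
  rw [Fin.snoc_last] at ha
  subst ha
  simp only [Fin.snoc_last, Fin.snoc_castSucc, Set.singleton_subset_iff, Set.mem_ofPred_eq]
  rw [iff_eq_eq]
  congr 1
  · exact Subsingleton.elim _ _
  · funext i
    refine Fin.lastCases ?_ (fun i => ?_) i
    · simp
    · simp

theorem models_Tbase (α : Type*) [LinearOrder α] : Set α ⊨ Tbase := by
  rw [Theory.model_iff]
  rintro φ (hφ | hφ)
  · simp only [Set.mem_insert_iff, Set.mem_singleton_iff] at hφ
    rcases hφ with rfl | rfl | rfl | rfl | rfl | rfl | rfl | rfl | rfl | rfl | rfl | rfl | rfl |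
      rfl | rfl
    · simp [axRefl, Sentence.Realize, Formula.Realize]
    · simp [axAntisymm, Sentence.Realize, Formula.Realize, Fin.snoc]
      exact fun a b => Set.Subset.antisymm
    · simp [axTrans, Sentence.Realize, Formula.Realize, Fin.snoc]
      exact fun a b c => Set.Subset.trans
    · simp [axBotLe, Sentence.Realize, Formula.Realize]
    · simp [axTop, Sentence.Realize, Formula.Realize, Fin.snoc]
      exact ⟨Set.univ, Set.subset_univ⟩
    · simp [axMeet, Sentence.Realize, Formula.Realize, Fin.snoc]
    · simp [axJoin, Sentence.Realize, Formula.Realize, Fin.snoc]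
    · simp only [axCompl, Sentence.Realize, Formula.Realize, BoundedFormula.realize_all,
        BoundedFormula.realize_ex]
      exact fun a => ⟨aᶜ, realize_isComplOf_of_eq_compl (by simp [Fin.snoc])⟩
    · simp [axDistrib, Sentence.Realize, Formula.Realize, Fin.snoc]
      rintro a b c _ _ _ _ _ rfl rfl rfl rfl rfl
      rw [Set.inter_union_distrib_left]
    · simp [axAt, Sentence.Realize, Formula.Realize, Fin.snoc]
    · simp [axAtomic, Sentence.Realize, Formula.Realize, Fin.snoc]
      exact fun a ha => Set.nonempty_iff_ne_empty.2 ha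
    · simp [axIrrefl, Sentence.Realize, Formula.Realize, Fin.snoc]
    · simp [axTransAt, Sentence.Realize, Formula.Realize, Fin.snoc]
      rintro _ _ _ x rfl y rfl z rfl
      simpa using fun hxy hyz => lt_trans hxy hyz
    · simp [axTrich, Sentence.Realize, Formula.Realize, Fin.snoc]
      rintro _ _ x rfl y rfl
      simpa [or_assoc] using lt_trichotomy x y
    · simp [axExleDef, Sentence.Realize, Formula.Realize, Fin.snoc]
      exact fun a b => ⟨fun ⟨x, hx, y, hy, h⟩ => ⟨y, x, ⟨hx, hy⟩, h⟩,
        fun ⟨y, x, ⟨hx, hy⟩, h⟩ => ⟨x, hx, y, hy, h⟩⟩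
  · obtain ⟨n, η, rfl⟩ := Set.mem_iUnion.1 hφ
    exact models_compAx α η

theorem models_TMSOFin (α : Type*) [LinearOrder α] [Finite α] : Set α ⊨ TMSOFin := by
  rw [Theory.model_iff]
  rintro φ (hφ | hφ)
  · exact (models_Tbase α).realize_of_mem φ hφ
  · simp only [Set.mem_insert_iff, Set.mem_singleton_iff] at hφ
    rcases hφ with rfl | rfl | rfl | rfl | rfl
    · simp [axLeastAtom, Sentence.Realize, Formula.Realize, Fin.snoc]
      intro a
      have : Nonempty α := ⟨a⟩
      exact Finite.exists_min id
    · simp [axGreatestAtom, Sentence.Realize, Formula.Realize, Fin.snoc]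
      intro a
      have : Nonempty α := ⟨a⟩
      exact Finite.exists_max id
    · simp [axSucc, Sentence.Realize, Formula.Realize, Fin.snoc]
      exact fun a x h => (exists_covBy_le_of_lt h).imp fun _ h => h.1
    · simp [axPred, Sentence.Realize, Formula.Realize, Fin.snoc]
      exact fun a x h => (exists_le_covBy_of_lt h).imp fun _ h => h.2
    · simp [axLeastIn, Sentence.Realize, Formula.Realize, Fin.snoc]
      exact fun a ha => Set.exists_min_image a id a.toFinite (Set.nonempty_iff_ne_empty.2 ha)

theorem models_psiGt {m n : ℕ} (h : n < m) : MSOn m ⊨ psiGt n := by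
  rw [psiGt, Sentence.Realize, BoundedFormula.realize_exs]
  refine ⟨fun i => {⟨i, by omega⟩}, ?_⟩
  simp [distinctPairs]
  rintro _ i j hij rfl
  simp [Fin.val_inj, hij.ne]

theorem models_rho {n d h : ℕ} (hd : 0 < d) (hn : d ≤ n) (hnh : n ≡ h [MOD d]) :
    MSOn n ⊨ rho d h := by
  rw [rho, dif_pos hd, Sentence.Realize, BoundedFormula.realize_exs]
  refine ⟨fun i => {a | a.val % d = i}, ?_⟩
  simp only [BoundedFormula.realize_inf, realize_bigAnd, List.mem_map, List.mem_flatMap,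
    List.mem_filterMap, List.mem_finRange, true_and]
  refine ⟨⟨⟨⟨⟨?_, ?_⟩, ?_⟩, ?_⟩, ?_⟩, ?_⟩
  · rintro _ ⟨i, rfl⟩
    have hi : i.val < n := i.isLt.trans_le hn
    rw [BoundedFormula.realize_not, realize_isBot']
    exact Set.nonempty_iff_ne_empty.1 ⟨⟨i, hi⟩, Nat.mod_eq_of_lt i.isLt⟩
  · simp
    exact fun a => ⟨⟨a % d, Nat.mod_lt _ hd⟩, rfl⟩
  · rintro φ ⟨i, j, hij⟩
    split_ifs at hij with hlt
    obtain rfl := Option.some.inj hij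
    simp
    intro a hi hj
    omega
  · simp
    rintro _ x rfl hx
    have : x.val = 0 := Nat.le_zero.1 (hx ⟨0, by omega⟩)
    simp [aIdx, this]
  · rintro _ ⟨j, rfl⟩
    simp
    rintro _ _ hx x rfl y rfl hxy
    simp at hx
    simp [cyc, ← hxy, ← hx]
  · simp
    rintro _ x rfl hx
    have hx' : x.val = n - 1 := by
      have : n - 1 ≤ x.val := hx ⟨n - 1, by omega⟩
      omega
    simp only [Set.singleton_subset_iff, Set.mem_ofPred_eq, aIdx, hx']
    refine Nat.ModEq.add_right_cancel' 1 ?_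
    rw [Nat.sub_add_cancel (by omega), Nat.sub_add_cancel (by omega)]
    simpa [Nat.ModEq] using hnh

theorem IsResidueFunctionTilde.modEq_of_dvd {rt : ℕ → ℕ} (h : IsResidueFunctionTilde rt)
    {d D : ℕ} (hd : 1 < d) (hD : 1 < D) (hdvd : d ∣ D) : rt D ≡ rt d [MOD d] := by
  obtain ⟨r, -, hr⟩ := h
  rw [Nat.modEq_iff_dvd, Int.natCast_dvd, Nat.dvd_iff_prime_pow_dvd_dvd]
  intro p k hp hk
  rcases Nat.eq_zero_or_pos k with rfl | hk0
  · simp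
  · rw [← Int.natCast_dvd, ← Nat.modEq_iff_dvd]
    exact ((hr D hD).2 p k hp hk0 (hk.trans hdvd)).trans ((hr d hd).2 p k hp hk0 hk).symm

theorem statement13 (rt : ℕ → ℕ) (h : IsResidueFunctionTilde rt) :
    (Trt rt).IsSatisfiable := by
  let T : ℕ → Lmso.Theory := fun m =>
    TMSOFin ∪ psiGt '' {n | n < m} ∪ {σ | ∃ d, 1 < d ∧ d ≤ m ∧ σ = rho d (rt d)}
  have hT : Monotone T := fun m m' hm => Set.union_subset_union
    (Set.union_subset_union_right _ (Set.image_mono fun n (hn : n < m) => hn.trans_le hm))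
    fun σ ⟨d, hd, hdm, hσ⟩ => ⟨d, hd, hdm.trans hm, hσ⟩
  have hsat : Theory.IsSatisfiable (⋃ m, T m) := by
    rw [Theory.isSatisfiable_directed_union_iff hT.directed_le]
    intro m
    set D := (m + 2).factorial with hD
    have hmD : m + 2 ≤ D := Nat.self_le_factorial _
    have : MSOn (rt D + D) ⊨ T m := by
      rw [Theory.model_iff]
      rintro σ ((hσ | ⟨n, hn, rfl⟩) | ⟨d, hd, hdm, rfl⟩)
      · exact (models_TMSOFin _).realize_of_mem σ hσ
      · rw [Set.mem_ofPred_eq] at hn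
        exact models_psiGt (by omega)
      · have hdD : d ∣ D := Nat.dvd_factorial (by omega) (by omega)
        refine models_rho (by omega) (by omega) ?_
        have := h.modEq_of_dvd hd (by omega) hdD
        simpa using this.add ((Nat.modEq_zero_iff_dvd).2 hdD)
    exact Theory.Model.isSatisfiable (MSOn (rt D + D))
  refine hsat.mono ?_
  rintro σ ((hσ | ⟨n, rfl⟩) | ⟨d, hd, rfl⟩)
  · exact Set.mem_iUnion.2 ⟨0, Or.inl (Or.inl hσ)⟩
  · exact Set.mem_iUnion.2 ⟨n + 1, Or.inl (Or.inr ⟨n, n.lt_succ_self, rfl⟩)⟩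
  · exact Set.mem_iUnion.2 ⟨d, Or.inr ⟨d, hd, le_rfl, rfl⟩⟩

end MSO
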